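/- arXiv:2210.02070 — 4 statements merged into one kernel-verified Lean document; each statement's English description precedes it below -/
import Mathlib

section
/- For all α > 0, β₁, β₂ ∈ (0,1) and c > 0, the autonomous Adam map T̄₀ (i.e. with ε = 0) satisfies T̄₀(x̃₁) = x̃₂ and T̄₀(x̃₂) = x̃₁, and x̃₁ ≠ x̃₂ (indeed m̃ ≠ 0 and w̃ ≠ 0). In particular x̃₁ is a fixed point of T̄₀ ∘ T̄₀ but not of T̄₀, so the Adam iteration without bias correction possesses a limit cycle of period exactly 2; moreover ṽ > 0, so the square roots occurring in the evaluation of T̄₀ at x̃₁ and x̃₂ are taken of strictly positive numbers. -/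
/-- The autonomous Adam map (without bias correction) with hyperparameters
`α, β₁, β₂, ε` for the scalar quadratic objective `f(w) = (1/2)·c·w²`,
acting on states `x = (m, v, w)`. -/
noncomputable def adamMap (α β₁ β₂ c ε : ℝ) (x : ℝ × ℝ × ℝ) : ℝ × ℝ × ℝ :=
  (β₁ * x.1 + (1 - β₁) * c * x.2.2,
   β₂ * x.2.1 + (1 - β₂) * c ^ 2 * x.2.2 ^ 2,
   x.2.2 - α * (β₁ * x.1 + (1 - β₁) * c * x.2.2) /
     Real.sqrt (β₂ * x.2.1 + (1 - β₂) * c ^ 2 * x.2.2 ^ 2 + ε))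

noncomputable def mTilde (α β₁ c : ℝ) : ℝ := α * c * (1 - β₁) ^ 2 / (2 * (1 + β₁) ^ 2)
noncomputable def vTilde (α β₁ c : ℝ) : ℝ := α ^ 2 * c ^ 2 * (1 - β₁) ^ 2 / (4 * (1 + β₁) ^ 2)
noncomputable def wTilde (α β₁ : ℝ) : ℝ := -(α * (1 - β₁)) / (2 * (1 + β₁))

/-- First point of the 2-cycle. -/
noncomputable def xTilde₁ (α β₁ c : ℝ) : ℝ × ℝ × ℝ :=
  (mTilde α β₁ c, vTilde α β₁ c, wTilde α β₁)

/-- Second point of the 2-cycle. -/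
noncomputable def xTilde₂ (α β₁ c : ℝ) : ℝ × ℝ × ℝ :=
  (-mTilde α β₁ c, vTilde α β₁ c, -wTilde α β₁)

lemma mTilde_pos {α β₁ c : ℝ} (hα : 0 < α) (hβ₁ : β₁ ∈ Set.Ioo (0 : ℝ) 1) (hc : 0 < c) :
    0 < mTilde α β₁ c := by
  have h₁ : 0 < 1 - β₁ := sub_pos.2 hβ₁.2
  have h₂ : 0 < 1 + β₁ := add_pos one_pos hβ₁.1
  unfold mTilde
  positivity

lemma wTilde_neg {α β₁ : ℝ} (hα : 0 < α) (hβ₁ : β₁ ∈ Set.Ioo (0 : ℝ) 1) :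
    wTilde α β₁ < 0 := by
  have h₁ : 0 < 1 - β₁ := sub_pos.2 hβ₁.2
  have h₂ : 0 < 1 + β₁ := add_pos one_pos hβ₁.1
  exact div_neg_of_neg_of_pos (neg_neg_of_pos (mul_pos hα h₁)) (by positivity)

lemma vTilde_eq (α β₁ c : ℝ) : vTilde α β₁ c = c ^ 2 * wTilde α β₁ ^ 2 := by
  unfold vTilde wTilde
  rw [div_pow]
  ring

lemma mTilde_recurrence (α c : ℝ) {β₁ : ℝ} (h : 1 + β₁ ≠ 0) :
    β₁ * mTilde α β₁ c + (1 - β₁) * c * wTilde α β₁ = -mTilde α β₁ c := by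
  unfold mTilde wTilde
  field_simp
  ring

lemma mul_mTilde_eq (α c : ℝ) {β₁ : ℝ} (h : 1 + β₁ ≠ 0) :
    α * mTilde α β₁ c = 2 * c * wTilde α β₁ ^ 2 := by
  unfold mTilde wTilde
  field_simp

/-- The second-moment update leaves `vTilde` unchanged. -/
lemma vTilde_recurrence (α β₁ β₂ c : ℝ) :
    β₂ * vTilde α β₁ c + (1 - β₂) * c ^ 2 * wTilde α β₁ ^ 2 = vTilde α β₁ c := by
  rw [vTilde_eq]
  ring

lemma sqrt_vTilde {α β₁ c : ℝ} (hα : 0 < α) (hβ₁ : β₁ ∈ Set.Ioo (0 : ℝ) 1) (hc : 0 < c) :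
    Real.sqrt (vTilde α β₁ c) = -(c * wTilde α β₁) := by
  rw [vTilde_eq, ← mul_pow, Real.sqrt_sq_eq_abs,
    abs_of_neg (mul_neg_of_pos_of_neg hc (wTilde_neg hα hβ₁))]

lemma adamMap_xTilde₁ {α β₁ c : ℝ} (β₂ : ℝ) (hα : 0 < α) (hβ₁ : β₁ ∈ Set.Ioo (0 : ℝ) 1)
    (hc : 0 < c) : adamMap α β₁ β₂ c 0 (xTilde₁ α β₁ c) = xTilde₂ α β₁ c := by
  have hw := (wTilde_neg hα hβ₁).ne
  have hβ : 1 + β₁ ≠ 0 := (add_pos one_pos hβ₁.1).ne'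
  simp only [adamMap, xTilde₁, xTilde₂, vTilde_recurrence, add_zero, sqrt_vTilde hα hβ₁ hc,
    mTilde_recurrence α c hβ, mul_neg, mul_mTilde_eq α c hβ, neg_div_neg_eq,
    Prod.mk.injEq, true_and]
  field_simp
  ring

/-- The Adam map commutes with the reflection `(m, v, w) ↦ (-m, v, -w)`. -/
lemma adamMap_reflect (α β₁ β₂ c ε m v w : ℝ) :
    adamMap α β₁ β₂ c ε (-m, v, -w) =
      (-(adamMap α β₁ β₂ c ε (m, v, w)).1, (adamMap α β₁ β₂ c ε (m, v, w)).2.1,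
        -(adamMap α β₁ β₂ c ε (m, v, w)).2.2) := by
  simp only [adamMap, neg_sq, Prod.mk.injEq, true_and]
  constructor <;> ring

lemma adamMap_xTilde₂ {α β₁ c : ℝ} (β₂ : ℝ) (hα : 0 < α) (hβ₁ : β₁ ∈ Set.Ioo (0 : ℝ) 1)
    (hc : 0 < c) : adamMap α β₁ β₂ c 0 (xTilde₂ α β₁ c) = xTilde₁ α β₁ c := by
  have h := adamMap_xTilde₁ β₂ hα hβ₁ hc
  rw [xTilde₁] at h
  rw [xTilde₂, adamMap_reflect, h]
  simp [xTilde₁, xTilde₂]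

/-- For all admissible hyperparameters and `ε = 0`, the autonomous Adam map swaps
`x̃₁` and `x̃₂`, which are distinct (indeed `m̃ ≠ 0` and `w̃ ≠ 0`); thus `x̃₁` is a
fixed point of `T̄₀ ∘ T̄₀` but not of `T̄₀`, giving a limit cycle of period exactly 2.
Moreover `ṽ > 0` and the square roots occurring in the evaluation of `T̄₀` at `x̃₁`
and `x̃₂` are taken of strictly positive numbers. -/
theorem adam_two_limit_cycle (α β₁ β₂ c : ℝ) (hα : 0 < α)
    (hβ₁ : β₁ ∈ Set.Ioo (0 : ℝ) 1) (hβ₂ : β₂ ∈ Set.Ioo (0 : ℝ) 1) (hc : 0 < c) :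
    adamMap α β₁ β₂ c 0 (xTilde₁ α β₁ c) = xTilde₂ α β₁ c ∧
    adamMap α β₁ β₂ c 0 (xTilde₂ α β₁ c) = xTilde₁ α β₁ c ∧
    xTilde₁ α β₁ c ≠ xTilde₂ α β₁ c ∧
    mTilde α β₁ c ≠ 0 ∧ wTilde α β₁ ≠ 0 ∧
    adamMap α β₁ β₂ c 0 (adamMap α β₁ β₂ c 0 (xTilde₁ α β₁ c)) = xTilde₁ α β₁ c ∧
    adamMap α β₁ β₂ c 0 (xTilde₁ α β₁ c) ≠ xTilde₁ α β₁ c ∧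
    0 < vTilde α β₁ c ∧
    0 < β₂ * vTilde α β₁ c + (1 - β₂) * c ^ 2 * (wTilde α β₁) ^ 2 ∧
    0 < β₂ * vTilde α β₁ c + (1 - β₂) * c ^ 2 * (-wTilde α β₁) ^ 2 := by
  have hm := mTilde_pos hα hβ₁ hc
  have hw := wTilde_neg hα hβ₁
  have hv : 0 < vTilde α β₁ c := by
    rw [vTilde_eq]
    exact mul_pos (pow_pos hc 2) (sq_pos_of_neg hw)
  have h₁ := adamMap_xTilde₁ β₂ hα hβ₁ hc
  have h₂ := adamMap_xTilde₂ β₂ hα hβ₁ hc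
  have hne : xTilde₁ α β₁ c ≠ xTilde₂ α β₁ c := fun h =>
    hm.ne' (self_eq_neg.1 (congrArg Prod.fst h))
  refine ⟨h₁, h₂, hne, hm.ne', hw.ne, ?_, ?_, hv, ?_, ?_⟩
  · rw [h₁, h₂]
  · rw [h₁]
    exact hne.symm
  · rwa [vTilde_recurrence]
  · rwa [neg_sq, vTilde_recurrence]
end

section
/- The spectrum of the linearization of the twice-iterated Adam map at the 2-cycle does not depend on the learning rate α or on the curvature c: for fixed β₁, β₂ ∈ (0,1) and any α, α' > 0 and c, c' > 0, the characteristic polynomial of the Jacobian matrix of T̄₀ ∘ T̄₀ (formed with hyperparameters α, c) at its 2-cycle point x̃₁(α, c) equals the characteristic polynomial of the Jacobian matrix of T̄₀ ∘ T̄₀ (formed with hyperparameters α', c') at its 2-cycle point x̃₁(α', c'). -/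
/-- The autonomous Adam map (without bias correction, `ε = 0` allowed via the
parameter) for `f(w) = (1/2)·c·w²`, on states `x = (m, v, w) ∈ ℝ³`. -/
noncomputable def adamF (α β₁ β₂ c ε : ℝ) (x : Fin 3 → ℝ) : Fin 3 → ℝ :=
  ![β₁ * x 0 + (1 - β₁) * c * x 2,
    β₂ * x 1 + (1 - β₂) * c ^ 2 * (x 2) ^ 2,
    x 2 - α * (β₁ * x 0 + (1 - β₁) * c * x 2) /
      Real.sqrt (β₂ * x 1 + (1 - β₂) * c ^ 2 * (x 2) ^ 2 + ε)]

/-- The 2-cycle point `x̃₁(α, c) = (m̃, ṽ, w̃)`. -/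
noncomputable def xF₁ (α β₁ c : ℝ) : Fin 3 → ℝ :=
  ![α * c * (1 - β₁) ^ 2 / (2 * (1 + β₁) ^ 2),
    α ^ 2 * c ^ 2 * (1 - β₁) ^ 2 / (4 * (1 + β₁) ^ 2),
    -(α * (1 - β₁)) / (2 * (1 + β₁))]

/-- The Jacobian matrix of `T̄₀ ∘ T̄₀` at a point `p`, with respect to the
coordinates `(m, v, w)`. -/
noncomputable def adamTwoStepJacobian (α β₁ β₂ c : ℝ) (p : Fin 3 → ℝ) :
    Matrix (Fin 3) (Fin 3) ℝ :=
  LinearMap.toMatrix'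
    (fderiv ℝ (fun y => adamF α β₁ β₂ c 0 (adamF α β₁ β₂ c 0 y)) p).toLinearMap

/-- Derivatives of conjugate self-maps of `ℝⁿ` have the same characteristic polynomial at
corresponding points. -/
theorem charpoly_toMatrix'_fderiv_of_semiconj {n : Type*} [Fintype n] [DecidableEq n]
    {f g : (n → ℝ) → n → ℝ} (e : (n → ℝ) ≃L[ℝ] (n → ℝ)) (h : Function.Semiconj e f g)
    (x : n → ℝ) :
    (LinearMap.toMatrix' (fderiv ℝ g (e x)).toLinearMap).charpoly =
      (LinearMap.toMatrix' (fderiv ℝ f x).toLinearMap).charpoly := by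
  have hderiv : (e : (n → ℝ) →L[ℝ] (n → ℝ)).comp (fderiv ℝ f x) =
      (fderiv ℝ g (e x)).comp (e : (n → ℝ) →L[ℝ] (n → ℝ)) := by
    rw [← e.comp_fderiv, ← e.comp_right_fderiv, h.comp_eq]
  have hconj : (fderiv ℝ g (e x)).toLinearMap =
      e.toLinearEquiv.conj (fderiv ℝ f x).toLinearMap := by
    refine LinearMap.ext fun y => ?_
    simpa using (DFunLike.congr_fun hderiv (e.symm y)).symm
  rw [← LinearMap.toMatrix_eq_toMatrix', LinearMap.charpoly_toMatrix, LinearMap.charpoly_toMatrix,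
    hconj, LinearEquiv.charpoly_conj]

/-- The coordinatewise rescaling `(m, v, w) ↦ (α c m, (α c)² v, α w)`. -/
noncomputable def adamRescale {α c : ℝ} (hα : α ≠ 0) (hc : c ≠ 0) :
    (Fin 3 → ℝ) ≃L[ℝ] (Fin 3 → ℝ) :=
  (LinearEquiv.piCongrRight fun i => LinearEquiv.smulOfNeZero ℝ ℝ (![α * c, (α * c) ^ 2, α] i)
    (by fin_cases i <;> simp [hα, hc])).toContinuousLinearEquiv

theorem adamRescale_apply {α c : ℝ} (hα : α ≠ 0) (hc : c ≠ 0) (x : Fin 3 → ℝ) :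
    adamRescale hα hc x = ![α * c * x 0, (α * c) ^ 2 * x 1, α * x 2] := by
  ext i
  fin_cases i <;> simp [adamRescale]

theorem adamRescale_semiconj {α c : ℝ} (β₁ β₂ : ℝ) (hα : 0 < α) (hc : 0 < c) :
    Function.Semiconj (adamRescale hα.ne' hc.ne') (adamF 1 β₁ β₂ 1 0) (adamF α β₁ β₂ c 0) := by
  intro x
  have hsqrt : √(β₂ * ((α * c) ^ 2 * x 1) + (1 - β₂) * c ^ 2 * (α * x 2) ^ 2) =
      α * c * √(β₂ * x 1 + (1 - β₂) * x 2 ^ 2) := by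
    rw [show β₂ * ((α * c) ^ 2 * x 1) + (1 - β₂) * c ^ 2 * (α * x 2) ^ 2 =
        (α * c) ^ 2 * (β₂ * x 1 + (1 - β₂) * x 2 ^ 2) by ring,
      Real.sqrt_mul (sq_nonneg _), Real.sqrt_sq (by positivity)]
  rw [adamRescale_apply, adamRescale_apply]
  ext i
  fin_cases i
  · simp [adamF]
    ring
  · simp [adamF]
    ring
  · simp only [adamF, Fin.reduceFinMk, Matrix.cons_val, add_zero, hsqrt, one_pow, mul_one, one_mul]
    rw [show α * (β₁ * (α * c * x 0) + (1 - β₁) * c * (α * x 2)) =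
        α * c * (α * (β₁ * x 0 + (1 - β₁) * x 2)) by ring,
      mul_div_mul_left _ _ (mul_pos hα hc).ne']
    ring

theorem adamRescale_xF₁ {α c : ℝ} (β₁ : ℝ) (hα : α ≠ 0) (hc : c ≠ 0) :
    adamRescale hα hc (xF₁ 1 β₁ 1) = xF₁ α β₁ c := by
  rw [adamRescale_apply]
  ext i
  fin_cases i <;> simp [xF₁] <;> ring

theorem charpoly_adamTwoStepJacobian_xF₁ {α c : ℝ} (β₁ β₂ : ℝ) (hα : 0 < α) (hc : 0 < c) :
    (adamTwoStepJacobian α β₁ β₂ c (xF₁ α β₁ c)).charpoly =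
      (adamTwoStepJacobian 1 β₁ β₂ 1 (xF₁ 1 β₁ 1)).charpoly := by
  have h := adamRescale_semiconj β₁ β₂ hα hc
  rw [← adamRescale_xF₁ β₁ hα.ne' hc.ne']
  exact charpoly_toMatrix'_fderiv_of_semiconj _ (h.comp_right h) _

/-- The characteristic polynomial of the Jacobian of `T̄₀ ∘ T̄₀` at the 2-cycle
point `x̃₁(α, c)` does not depend on the learning rate `α` or the curvature `c`. -/
theorem adam_two_cycle_charpoly_independent_of_alpha_c (β₁ β₂ : ℝ)
    (hβ₁ : β₁ ∈ Set.Ioo (0 : ℝ) 1) (hβ₂ : β₂ ∈ Set.Ioo (0 : ℝ) 1)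
    (α α' c c' : ℝ) (hα : 0 < α) (hα' : 0 < α') (hc : 0 < c) (hc' : 0 < c') :
    (adamTwoStepJacobian α β₁ β₂ c (xF₁ α β₁ c)).charpoly =
      (adamTwoStepJacobian α' β₁ β₂ c' (xF₁ α' β₁ c')).charpoly := by
  rw [charpoly_adamTwoStepJacobian_xF₁ β₁ β₂ hα hc,
    charpoly_adamTwoStepJacobian_xF₁ β₁ β₂ hα' hc']
end

section
/- Fix α > 0, β₁, β₂ ∈ (0,1), ε > 0 and c > 0. Define the perturbation Θ : ℕ × (ℝ × [0,∞) × ℝ) → ℝ³ by Θ(t, (m, v, w)) = (0, 0, −α·( √(1 − β₂^{t+1})/(1 − β₁^{t+1}) − 1 )·m'/√(v' + ε)), where m' = β₁·m + (1−β₁)·c·w and v' = β₂·v + (1−β₂)·c²·w². Then there exist C ≥ 0 and β ∈ (0,1) such that ‖Θ(t, x)‖ ≤ C·β^t·‖x‖ for all t ∈ ℕ and all x = (m, v, w) with v ≥ 0; in particular the difference between the bias-corrected Adam map T(t, x) and the autonomous Adam map T̄_ε(x) decays exponentially in t, uniformly on bounded sets. -/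
/-- The Euclidean norm of `(m, v, w) ∈ ℝ³`. -/
noncomputable def euclNorm3 (m v w : ℝ) : ℝ := Real.sqrt (m ^ 2 + v ^ 2 + w ^ 2)

/-- The bias-correction perturbation `Θ(t, (m,v,w))` of Adam for
`f(w) = (1/2)·c·w²`: its only nonzero component is the third one,
`−α·(√(1 − β₂^{t+1})/(1 − β₁^{t+1}) − 1)·m'/√(v' + ε)`. -/
noncomputable def adamTheta3 (α β₁ β₂ c ε : ℝ) (t : ℕ) (m v w : ℝ) : ℝ :=
  -α * (Real.sqrt (1 - β₂ ^ (t + 1)) / (1 - β₁ ^ (t + 1)) - 1) *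
    (β₁ * m + (1 - β₁) * c * w) /
      Real.sqrt (β₂ * v + (1 - β₂) * c ^ 2 * w ^ 2 + ε)

theorem abs_le_euclNorm3_fst (m v w : ℝ) : |m| ≤ euclNorm3 m v w :=
  Real.abs_le_sqrt (by nlinarith [sq_nonneg v, sq_nonneg w])

theorem abs_le_euclNorm3_trd (m v w : ℝ) : |w| ≤ euclNorm3 m v w :=
  Real.abs_le_sqrt (by nlinarith [sq_nonneg m, sq_nonneg v])

theorem euclNorm3_zero_zero (w : ℝ) : euclNorm3 0 0 w = |w| := by
  simp [euclNorm3, Real.sqrt_sq_eq_abs]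

/-- The bias-correction factor differs from `1` by at most `(x + y) / (1 - y)`. -/
theorem abs_sqrt_div_sub_one_le {x y : ℝ} (hx0 : 0 ≤ x) (hx1 : x ≤ 1) (hy0 : 0 ≤ y)
    (hy1 : y < 1) : |√(1 - x) / (1 - y) - 1| ≤ (x + y) / (1 - y) := by
  have hy : 0 < 1 - y := sub_pos.2 hy1
  have hle : √(1 - x) ≤ 1 := Real.sqrt_le_one.2 (by linarith)
  have hge : 1 - x ≤ √(1 - x) := Real.le_sqrt_of_sq_le (by nlinarith)
  rw [div_sub_one hy.ne', abs_div, abs_of_pos hy]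
  gcongr
  rw [abs_le]
  constructor <;> linarith

/-- The bias-correction factor converges to `1` geometrically. -/
theorem abs_biasCorrection_sub_one_le {β₁ β₂ : ℝ} (hβ₁ : β₁ ∈ Set.Ioo (0 : ℝ) 1)
    (hβ₂ : β₂ ∈ Set.Ioo (0 : ℝ) 1) (t : ℕ) :
    |√(1 - β₂ ^ (t + 1)) / (1 - β₁ ^ (t + 1)) - 1| ≤ 2 / (1 - β₁) * max β₁ β₂ ^ t := by
  obtain ⟨h₁, h₁'⟩ := hβ₁
  obtain ⟨h₂, h₂'⟩ := hβ₂
  have hy : β₁ ^ (t + 1) ≤ β₁ := pow_le_of_le_one h₁.le h₁'.le t.succ_ne_zero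
  have hx : β₂ ^ (t + 1) ≤ β₂ := pow_le_of_le_one h₂.le h₂'.le t.succ_ne_zero
  have hyt : β₁ ^ (t + 1) ≤ max β₁ β₂ ^ t :=
    (pow_le_pow_of_le_one h₁.le h₁'.le t.le_succ).trans
      (pow_le_pow_left₀ h₁.le (le_max_left _ _) t)
  have hxt : β₂ ^ (t + 1) ≤ max β₁ β₂ ^ t :=
    (pow_le_pow_of_le_one h₂.le h₂'.le t.le_succ).trans
      (pow_le_pow_left₀ h₂.le (le_max_right _ _) t)
  have hpos : 0 < 1 - β₁ := sub_pos.2 h₁'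
  calc |√(1 - β₂ ^ (t + 1)) / (1 - β₁ ^ (t + 1)) - 1|
      ≤ (β₂ ^ (t + 1) + β₁ ^ (t + 1)) / (1 - β₁ ^ (t + 1)) :=
        abs_sqrt_div_sub_one_le (by positivity) (hx.trans h₂'.le) (by positivity)
          (hy.trans_lt h₁')
    _ ≤ (2 * max β₁ β₂ ^ t) / (1 - β₁) :=
        div_le_div₀ (by positivity) (by linarith) hpos (by linarith)
    _ = 2 / (1 - β₁) * max β₁ β₂ ^ t := by ring

/-- The updated first moment is bounded by a multiple of the norm of the state. -/
theorem abs_momentum_le {β₁ c : ℝ} (hβ₁ : β₁ ∈ Set.Ioo (0 : ℝ) 1) (hc : 0 < c) (m v w : ℝ) :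
    |β₁ * m + (1 - β₁) * c * w| ≤ (1 + c) * euclNorm3 m v w := by
  obtain ⟨h₁, h₁'⟩ := hβ₁
  have hpos : 0 < 1 - β₁ := sub_pos.2 h₁'
  calc |β₁ * m + (1 - β₁) * c * w|
      ≤ |β₁ * m| + |(1 - β₁) * c * w| := abs_add_le _ _
    _ = β₁ * |m| + (1 - β₁) * c * |w| := by
        rw [abs_mul, abs_mul, abs_of_pos h₁, abs_of_pos (mul_pos hpos hc)]
    _ ≤ 1 * euclNorm3 m v w + 1 * c * euclNorm3 m v w := by
        gcongr
        · exact abs_le_euclNorm3_fst m v w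
        · linarith
        · exact abs_le_euclNorm3_trd m v w
    _ = (1 + c) * euclNorm3 m v w := by ring

/-- The bias-correction perturbation decays exponentially in `t`, linearly in the
state: there exist `C ≥ 0` and `β ∈ (0,1)` with
`‖Θ(t, x)‖ ≤ C·β^t·‖x‖` for all `t ∈ ℕ` and all `x = (m, v, w)` with `v ≥ 0`
(so the bias-corrected Adam map approaches the autonomous one exponentially,
uniformly on bounded sets). -/
theorem adam_bias_perturbation_exponential_bound (α β₁ β₂ ε c : ℝ) (hα : 0 < α)
    (hβ₁ : β₁ ∈ Set.Ioo (0 : ℝ) 1) (hβ₂ : β₂ ∈ Set.Ioo (0 : ℝ) 1)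
    (hε : 0 < ε) (hc : 0 < c) :
    ∃ C ≥ (0 : ℝ), ∃ β ∈ Set.Ioo (0 : ℝ) 1,
      ∀ t : ℕ, ∀ m v w : ℝ, 0 ≤ v →
        euclNorm3 0 0 (adamTheta3 α β₁ β₂ c ε t m v w) ≤
          C * β ^ t * euclNorm3 m v w := by
  have hpos : 0 < 1 - β₁ := sub_pos.2 hβ₁.2
  refine ⟨α * (2 / (1 - β₁)) * (1 + c) / √ε, by positivity, max β₁ β₂,
    ⟨lt_max_of_lt_left hβ₁.1, max_lt hβ₁.2 hβ₂.2⟩, fun t m v w hv => ?_⟩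
  have hβ₂' : 0 < 1 - β₂ := sub_pos.2 hβ₂.2
  have hβ₂0 : 0 < β₂ := hβ₂.1
  have hmax : 0 < max β₁ β₂ := lt_max_of_lt_left hβ₁.1
  have hden : √ε ≤ √(β₂ * v + (1 - β₂) * c ^ 2 * w ^ 2 + ε) :=
    Real.sqrt_le_sqrt (le_add_of_nonneg_left (by positivity))
  have hnorm : 0 ≤ euclNorm3 m v w := Real.sqrt_nonneg _
  rw [euclNorm3_zero_zero, adamTheta3, abs_div, abs_mul, abs_mul, abs_neg, abs_of_pos hα,
    abs_of_nonneg (Real.sqrt_nonneg (_ + ε))]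
  calc _ ≤ α * (2 / (1 - β₁) * max β₁ β₂ ^ t) * ((1 + c) * euclNorm3 m v w) / √ε := by
        gcongr
        · exact abs_biasCorrection_sub_one_le hβ₁ hβ₂ t
        · exact abs_momentum_le hβ₁ hc m v w
    _ = _ := by ring
end

section
/- Let n ∈ ℕ, α > 0, β₁, β₂ ∈ (0,1) and c₁, …, c_n > 0, and consider the componentwise autonomous Adam map T̄₀ : (ℝ³)ⁿ → (ℝ³)ⁿ (without bias correction, ε = 0) for the diagonal strictly convex quadratic objective f(w) = (1/2)·Σᵢ cᵢ·wᵢ², i.e. in each coordinate i the update is mᵢ' = β₁·mᵢ + (1−β₁)·cᵢ·wᵢ, vᵢ' = β₂·vᵢ + (1−β₂)·cᵢ²·wᵢ², wᵢ' = wᵢ − α·mᵢ'/√(vᵢ'). Then the point x̃₁ whose i-th coordinates are m̃ᵢ = α·cᵢ·(1−β₁)²/(2·(1+β₁)²), ṽᵢ = α²·cᵢ²·(1−β₁)²/(4·(1+β₁)²), w̃ᵢ = −α·(1−β₁)/(2·(1+β₁)) satisfies T̄₀(x̃₁) = x̃₂ and T̄₀(x̃₂) = x̃₁, where x̃₂ has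 coordinates (−m̃ᵢ, ṽᵢ, −w̃ᵢ); moreover x̃₁ ≠ x̃₂, so the multidimensional Adam iteration for this strictly convex quadratic objective has a limit cycle of period exactly 2 and therefore does not converge globally to the unique minimizer w = 0. -/
/-- The componentwise autonomous Adam map (without bias correction, `ε = 0`) for
the diagonal strictly convex quadratic objective `f(w) = (1/2)·Σᵢ cᵢ·wᵢ²`:
each coordinate `i` carries a scalar Adam state `(mᵢ, vᵢ, wᵢ)` evolving with
curvature `cᵢ`. -/
noncomputable def adamVec (n : ℕ) (α β₁ β₂ : ℝ) (cv : Fin n → ℝ)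
    (x : Fin n → ℝ × ℝ × ℝ) : Fin n → ℝ × ℝ × ℝ := fun i =>
  (β₁ * (x i).1 + (1 - β₁) * cv i * (x i).2.2,
   β₂ * (x i).2.1 + (1 - β₂) * (cv i) ^ 2 * (x i).2.2 ^ 2,
   (x i).2.2 - α * (β₁ * (x i).1 + (1 - β₁) * cv i * (x i).2.2) /
     Real.sqrt (β₂ * (x i).2.1 + (1 - β₂) * (cv i) ^ 2 * (x i).2.2 ^ 2))

/-- First point of the multidimensional 2-cycle. -/
noncomputable def xVec₁ (n : ℕ) (α β₁ : ℝ) (cv : Fin n → ℝ) :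
    Fin n → ℝ × ℝ × ℝ := fun i =>
  (α * cv i * (1 - β₁) ^ 2 / (2 * (1 + β₁) ^ 2),
   α ^ 2 * (cv i) ^ 2 * (1 - β₁) ^ 2 / (4 * (1 + β₁) ^ 2),
   -(α * (1 - β₁)) / (2 * (1 + β₁)))

/-- Second point of the multidimensional 2-cycle. -/
noncomputable def xVec₂ (n : ℕ) (α β₁ : ℝ) (cv : Fin n → ℝ) :
    Fin n → ℝ × ℝ × ℝ := fun i =>
  (-(α * cv i * (1 - β₁) ^ 2 / (2 * (1 + β₁) ^ 2)),
   α ^ 2 * (cv i) ^ 2 * (1 - β₁) ^ 2 / (4 * (1 + β₁) ^ 2),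
   -(-(α * (1 - β₁)) / (2 * (1 + β₁))))

/-- The square root of the updated second moment at either point of the cycle. -/
lemma sqrt_second_moment {α β₁ c : ℝ} (β₂ : ℝ) (hα : 0 < α) (hβ₁ : β₁ ∈ Set.Ioo (0 : ℝ) 1)
    (hc : 0 < c) :
    Real.sqrt (β₂ * (α ^ 2 * c ^ 2 * (1 - β₁) ^ 2 / (4 * (1 + β₁) ^ 2)) +
      (1 - β₂) * c ^ 2 * (-(α * (1 - β₁)) / (2 * (1 + β₁))) ^ 2) =
      α * c * (1 - β₁) / (2 * (1 + β₁)) := by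
  have h₀ : 0 < 1 + β₁ := by linarith [hβ₁.1]
  have h₁ : 0 < 1 - β₁ := by linarith [hβ₁.2]
  rw [← Real.sqrt_sq (show 0 ≤ α * c * (1 - β₁) / (2 * (1 + β₁)) by positivity)]
  congr 1
  field_simp
  ring

lemma adamVec_xVec₁ (n : ℕ) {α β₁ : ℝ} (β₂ : ℝ) {cv : Fin n → ℝ} (hα : 0 < α)
    (hβ₁ : β₁ ∈ Set.Ioo (0 : ℝ) 1) (hcv : ∀ i, 0 < cv i) :
    adamVec n α β₁ β₂ cv (xVec₁ n α β₁ cv) = xVec₂ n α β₁ cv := by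
  have h₀ : 1 + β₁ ≠ 0 := by linarith [hβ₁.1]
  have h₁ : 1 - β₁ ≠ 0 := by linarith [hβ₁.2]
  funext i
  have hc := (hcv i).ne'
  simp only [adamVec, xVec₁, xVec₂, sqrt_second_moment β₂ hα hβ₁ (hcv i), Prod.mk.injEq]
  refine ⟨?_, ?_, ?_⟩ <;> field_simp <;> ring

lemma xVec₂_eq (n : ℕ) (α β₁ : ℝ) (cv : Fin n → ℝ) (i : Fin n) :
    xVec₂ n α β₁ cv i =
      (-(xVec₁ n α β₁ cv i).1, (xVec₁ n α β₁ cv i).2.1, -(xVec₁ n α β₁ cv i).2.2) := rfl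

/-- The Adam map commutes with the reflection `(m, v, w) ↦ (-m, v, -w)`. -/
lemma adamVec_reflect (n : ℕ) (α β₁ β₂ : ℝ) (cv : Fin n → ℝ) (x : Fin n → ℝ × ℝ × ℝ)
    (i : Fin n) :
    adamVec n α β₁ β₂ cv (fun j => (-(x j).1, (x j).2.1, -(x j).2.2)) i =
      (-(adamVec n α β₁ β₂ cv x i).1, (adamVec n α β₁ β₂ cv x i).2.1,
        -(adamVec n α β₁ β₂ cv x i).2.2) := by
  simp only [adamVec, Prod.mk.injEq, neg_sq, true_and]
  constructor <;> ring

lemma adamVec_xVec₂ (n : ℕ) {α β₁ : ℝ} (β₂ : ℝ) {cv : Fin n → ℝ} (hα : 0 < α)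
    (hβ₁ : β₁ ∈ Set.Ioo (0 : ℝ) 1) (hcv : ∀ i, 0 < cv i) :
    adamVec n α β₁ β₂ cv (xVec₂ n α β₁ cv) = xVec₁ n α β₁ cv := by
  funext i
  rw [funext (xVec₂_eq n α β₁ cv), adamVec_reflect, adamVec_xVec₁ n β₂ hα hβ₁ hcv]
  simp [xVec₂_eq]

/-- For the diagonal strictly convex quadratic objective, the componentwise Adam
map without bias correction swaps the two distinct points `x̃₁` and `x̃₂`:
a limit cycle of period exactly 2, so the multidimensional Adam iteration does
not converge globally to the unique minimizer `w = 0`. -/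
theorem adam_multidimensional_two_cycle (n : ℕ) (hn : 0 < n) (α β₁ β₂ : ℝ)
    (cv : Fin n → ℝ) (hα : 0 < α)
    (hβ₁ : β₁ ∈ Set.Ioo (0 : ℝ) 1) (hβ₂ : β₂ ∈ Set.Ioo (0 : ℝ) 1)
    (hcv : ∀ i, 0 < cv i) :
    adamVec n α β₁ β₂ cv (xVec₁ n α β₁ cv) = xVec₂ n α β₁ cv ∧
    adamVec n α β₁ β₂ cv (xVec₂ n α β₁ cv) = xVec₁ n α β₁ cv ∧
    xVec₁ n α β₁ cv ≠ xVec₂ n α β₁ cv ∧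
    ∀ x : ℕ → Fin n → ℝ × ℝ × ℝ, x 0 = xVec₁ n α β₁ cv →
      (∀ t : ℕ, x (t + 1) = adamVec n α β₁ β₂ cv (x t)) →
      ¬ Filter.Tendsto (fun t : ℕ => fun i : Fin n => (x t i).2.2)
          Filter.atTop (nhds 0) := by
  have h₁₂ := adamVec_xVec₁ n β₂ hα hβ₁ hcv
  have h₂₁ := adamVec_xVec₂ n β₂ hα hβ₁ hcv
  let i : Fin n := ⟨0, hn⟩
  have hw : (xVec₁ n α β₁ cv i).2.2 < 0 := by
    have h₀ : 0 < 1 + β₁ := by linarith [hβ₁.1]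
    have h₁ : 0 < 1 - β₁ := by linarith [hβ₁.2]
    exact div_neg_of_neg_of_pos (neg_neg_of_pos (by positivity)) (by positivity)
  refine ⟨h₁₂, h₂₁, fun h => ?_, fun x hx₀ hx hlim => ?_⟩
  · have hi : (xVec₁ n α β₁ cv i).2.2 = -(xVec₁ n α β₁ cv i).2.2 :=
      congrArg (fun y => (y i).2.2) h
    linarith
  · have horbit : ∀ t, x t = xVec₁ n α β₁ cv ∨ x t = xVec₂ n α β₁ cv := by
      intro t
      induction t with
      | zero => exact .inl hx₀
      | succ t ih =>
        rcases ih with h | h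
        · exact .inr (by rw [hx, h, h₁₂])
        · exact .inl (by rw [hx, h, h₂₁])
    have habs : ∀ t, |(x t i).2.2| = |(xVec₁ n α β₁ cv i).2.2| := by
      intro t
      rcases horbit t with h | h
      · rw [h]
      · rw [h, xVec₂_eq, abs_neg]
    have hi := (tendsto_pi_nhds.1 hlim i).abs
    simp only [habs, Pi.zero_apply, abs_zero] at hi
    exact hw.ne (abs_eq_zero.1 (tendsto_nhds_unique tendsto_const_nhds hi))
end
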